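/- Let X be a measurable space, c > 0, and K a kernel on X such that K(x,X) < ∞ for every x ∈ X and with the following compactness property: every sequence (g_n) of Borel functions on X with |g_n| ≤ c admits a subsequence along which (Kg_n) converges uniformly on X. Let φ : X × ℝ → ℝ be Borel measurable with |φ| ≤ c and t ↦ φ(x,t) continuous for every x ∈ X. Then for every Borel function v : X → ℝ there exists a Borel function u : X → ℝ such that u + Kφ(·,u) = v; in particular |u − v| ≤ c·K1. If moreover X is a topological space with its Borel σ-algebra, Kg is continuous for every Borel g with |g| ≤ c, and v is continuous, then u can be chosen continuous. -/

import Mathlib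

open MeasureTheory ProbabilityTheory Filter
open scoped ENNReal

open scoped Classical in
/-- For a family of `n` linear orders, given by injective ranks, a set `D` of `n - 1` elements
that no point exceeds in all orders has exactly two one-point extensions with this property. -/
theorem Finset.card_insert_dominating_eq_two {P ι : Type*} [Fintype P] [Fintype ι]
    {r : ι → P → ℕ} (hr : ∀ i, Function.Injective (r i))
    {D : Finset P} (hcard : D.card + 1 = Fintype.card ι) (hne : D.Nonempty)
    (hD : ∀ y, ∃ i, ∀ b ∈ D, r i y ≤ r i b)
    (hS : ∀ a, ∃ s, ∀ j ≠ a, ∃ b ∈ D, r j b < r j s) :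
    (Finset.univ.filter fun x => x ∉ D ∧ ∀ y, ∃ i, ∀ b ∈ insert x D, r i y ≤ r i b).card = 2 := by
  choose m hmD hm using fun i => D.exists_min_image (r i) hne
  have hsurj : ∀ b ∈ D, ∃ i, m i = b := fun b hb => by
    obtain ⟨i, hi⟩ := hD b
    exact ⟨i, hr i (le_antisymm (hm i b hb) (hi _ (hmD i)))⟩
  obtain ⟨a, -, b, -, hab, hmab⟩ := Finset.exists_ne_map_eq_of_card_lt_of_maps_to
    (s := (Finset.univ : Finset ι)) (t := D) (f := m)
    (by rw [Finset.card_univ]; omega) (fun i _ => hmD i)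
  -- an index set of size `card D` on which `m` is onto `D` omits `a` or `b`
  have hinj : ∀ i, (∀ d ∈ D, ∃ j ≠ i, m j = d) → i = a ∨ i = b := by
    intro i hi
    by_contra! h
    have hc : (Finset.univ.erase i).card ≤ D.card := by
      rw [Finset.card_erase_of_mem (Finset.mem_univ _), Finset.card_univ]; omega
    have := Finset.inj_on_of_surj_on_of_card_le (s := Finset.univ.erase i) (t := D)
      (fun j _ => m j) (fun j _ => hmD j)
      (fun d hd => by
        obtain ⟨j, hj, hjd⟩ := hi d hd
        exact ⟨j, by simpa using hj, hjd⟩) hc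
    exact hab (this (a₁ := a) (a₂ := b) (by simpa using h.1.symm) (by simpa using h.2.symm) hmab)
  have hsurj' : ∀ i, i = a ∨ i = b → ∀ d ∈ D, ∃ j ≠ i, m j = d := by
    intro i hi d hd
    obtain ⟨j, rfl⟩ := hsurj d hd
    by_cases hj : j = i
    · subst hj
      rcases hi with rfl | rfl
      · exact ⟨b, hab.symm, hmab.symm⟩
      · exact ⟨a, hab, hmab⟩
    · exact ⟨j, hj, rfl⟩
  have hmax : ∀ i, ∃ x, (∀ j ≠ i, r j (m j) < r j x) ∧
      ∀ y, (∀ j ≠ i, r j (m j) < r j y) → r i y ≤ r i x := by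
    intro i
    obtain ⟨s, hs⟩ := hS i
    obtain ⟨x, hx, hx'⟩ := (Finset.univ.filter fun y => ∀ j ≠ i, r j (m j) < r j y).exists_max_image
      (r i) ⟨s, by
        simp only [Finset.mem_filter, Finset.mem_univ, true_and]
        intro j hj
        obtain ⟨d, hd, hlt⟩ := hs j hj
        exact (hm j d hd).trans_lt hlt⟩
    simp only [Finset.mem_filter, Finset.mem_univ, true_and] at hx hx'
    exact ⟨x, hx, hx'⟩
  choose z hz hzmax using hmax
  -- a point of the region attached to `i` is dominated in the order `i`
  have hdom : ∀ i y, (∀ j ≠ i, r j (m j) < r j y) → ∀ d ∈ D, r i y ≤ r i d := by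
    intro i y hy
    obtain ⟨k, hk⟩ := hD y
    by_cases hki : k = i
    · exact hki ▸ hk
    · exact absurd (hk _ (hmD k)) (not_le.2 (hy k hki))
  rw [Finset.card_eq_two]
  refine ⟨z a, z b, fun h => ?_, ?_⟩
  · obtain ⟨k, hk⟩ := hD (z a)
    refine absurd (hk _ (hmD k)) (not_le.2 ?_)
    by_cases hka : k = a
    · rw [h]; exact hz b k (hka ▸ hab)
    · exact hz a k hka
  · ext x
    rw [Finset.mem_filter, Finset.mem_insert, Finset.mem_singleton]
    constructor
    · rintro ⟨-, hx, hdx⟩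
      obtain ⟨i, hi⟩ := hdx x
      have hlt : ∀ d ∈ D, ∃ j, m j = d ∧ r j (m j) < r j x := by
        intro d hd
        obtain ⟨j, hj⟩ := hdx d
        have hjd : m j = d :=
          hr j (le_antisymm (hm j d hd) (hj _ (Finset.mem_insert_of_mem (hmD j))))
        refine ⟨j, hjd, lt_of_le_of_ne (hjd ▸ hj x (Finset.mem_insert_self _ _)) fun h => hx ?_⟩
        rw [← hr j h]; exact hmD j
      have hi' : ∀ d ∈ D, ∃ j ≠ i, m j = d := by
        intro d hd
        obtain ⟨j, hjd, hj⟩ := hlt d hd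
        refine ⟨j, ?_, hjd⟩
        rintro rfl
        exact absurd (hi _ (Finset.mem_insert_of_mem (hmD j))) (not_le.2 hj)
      have hxS : ∀ j ≠ i, r j (m j) < r j x := by
        have hU : (Finset.univ.erase i) ⊆ Finset.univ.filter fun j => r j (m j) < r j x := by
          have hsub : (Finset.univ.filter fun j => r j (m j) < r j x) ⊆ Finset.univ.erase i := by
            intro j hj
            simp only [Finset.mem_filter, Finset.mem_univ, true_and] at hj
            rw [Finset.mem_erase]
            refine ⟨?_, Finset.mem_univ _⟩
            rintro rfl
            exact absurd (hi _ (Finset.mem_insert_of_mem (hmD j))) (not_le.2 hj)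
          refine (Finset.eq_of_subset_of_card_le hsub ?_).ge
          rw [Finset.card_erase_of_mem (Finset.mem_univ _), Finset.card_univ, ← hcard,
            Nat.add_sub_cancel]
          refine Finset.card_le_card_of_surjOn m fun d hd => ?_
          obtain ⟨j, hjd, hj⟩ := hlt d hd
          exact ⟨j, by simpa using hj, hjd⟩
        intro j hj
        simpa using hU (Finset.mem_erase.2 ⟨hj, Finset.mem_univ _⟩)
      have hxz : x = z i := by
        refine hr i (le_antisymm (hzmax i x hxS) ?_)
        obtain ⟨k, hk⟩ := hdx (z i)
        by_cases hki : k = i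
        · exact hki ▸ hk x (Finset.mem_insert_self _ _)
        · exact absurd (hk _ (Finset.mem_insert_of_mem (hmD k))) (not_le.2 (hz i k hki))
      rcases hinj i hi' with rfl | rfl
      · exact Or.inl hxz
      · exact Or.inr hxz
    · intro hx
      obtain ⟨i, hi, rfl⟩ : ∃ i, (i = a ∨ i = b) ∧ x = z i := by
        rcases hx with rfl | rfl
        exacts [⟨a, .inl rfl, rfl⟩, ⟨b, .inr rfl, rfl⟩]
      refine ⟨Finset.mem_univ _, fun h => ?_, fun y => ?_⟩
      · obtain ⟨j, hj, hjz⟩ := hsurj' i hi _ h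
        exact absurd (hz i j hj) (by rw [hjz]; exact lt_irrefl _)
      · by_cases hy : ∀ j ≠ i, r j (m j) < r j y
        · refine ⟨i, fun d hd => ?_⟩
          rcases Finset.mem_insert.1 hd with rfl | hd
          · exact hzmax i y hy
          · exact hdom i y hy d hd
        · push Not at hy
          obtain ⟨j, hj, hle⟩ := hy
          refine ⟨j, fun d hd => ?_⟩
          rcases Finset.mem_insert.1 hd with rfl | hd
          · exact hle.trans (hz i j hj).le
          · exact hle.trans (hm j d hd)

open scoped Classical in
/-- If a colouring of a set of `n` elements misses one of the `n` colours, then an even number of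
one-point deletions have exactly the colours other than `i₀`. -/
theorem Finset.even_card_filter_image_erase_eq {P ι : Type*} [Fintype ι] {B : Finset P} (c : P → ι)
    (i₀ : ι) (hcard : B.card = Fintype.card ι) (hB : B.image c ≠ Finset.univ) :
    Even (B.filter fun x => (B.erase x).image c = Finset.univ.erase i₀).card := by
  rcases (B.filter fun x => (B.erase x).image c = Finset.univ.erase i₀).eq_empty_or_nonempty with
    h | ⟨x, hx⟩
  · simp [h]
  obtain ⟨hxB, hx⟩ := Finset.mem_filter.1 hx
  have hc0 : c x ≠ i₀ := by
    intro h
    apply hB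
    rw [← Finset.insert_erase hxB, Finset.image_insert, hx, h,
      Finset.insert_erase (Finset.mem_univ _)]
  have hcardE : ∀ z ∈ B, (B.erase z).card = (Finset.univ.erase i₀ : Finset ι).card := by
    intro z hz
    rw [Finset.card_erase_of_mem hz, Finset.card_erase_of_mem (Finset.mem_univ _), hcard,
      Finset.card_univ]
  have hinj : ∀ z ∈ B, (B.erase z).image c = Finset.univ.erase i₀ →
      Set.InjOn c (B.erase z) := by
    intro z hz h
    rw [← Finset.card_image_iff, h, hcardE z hz]
  obtain ⟨x', hx', hcx⟩ : ∃ x' ∈ B.erase x, c x' = c x := by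
    rw [← Finset.mem_image, hx]
    simpa using hc0
  obtain ⟨hne, hx'B⟩ := Finset.mem_erase.1 hx'
  suffices h : B.filter (fun x => (B.erase x).image c = Finset.univ.erase i₀) = {x, x'} by
    rw [h, Finset.card_pair hne.symm]; exact even_two
  ext z
  simp only [Finset.mem_filter, Finset.mem_insert, Finset.mem_singleton]
  constructor
  · rintro ⟨hzB, hz⟩
    by_contra! h
    exact hne (hinj z hzB hz (by simpa using ⟨hx'B, h.2.symm⟩)
      (by simpa using ⟨hxB, h.1.symm⟩) hcx)
  · rintro (rfl | rfl)
    · exact ⟨hxB, hx⟩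
    · refine ⟨hx'B, ?_⟩
      rw [← hx, ← Finset.insert_erase (Finset.mem_erase.2 ⟨hne.symm, hxB⟩),
        ← Finset.insert_erase hx', Finset.image_insert, Finset.image_insert, hcx,
        Finset.erase_right_comm]

open scoped Classical in
/-- A form of Scarf's combinatorial lemma. -/
theorem Finset.exists_dominating_image_eq_univ {P ι : Type*} [Fintype P] [Fintype ι] [Nonempty ι]
    {r : ι → P → ℕ} (hr : ∀ i, Function.Injective (r i)) {s : ι → P}
    (hbot : ∀ i y, r i (s i) ≤ r i y)
    (htop : ∀ i j y, i ≠ j → y ∉ Set.range s → r i y < r i (s j))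
    (hs : ∃ y, y ∉ Set.range s) {c : P → ι} (hc : ∀ i, c (s i) = i) :
    ∃ B : Finset P, (∀ y, ∃ i, ∀ b ∈ B, r i y ≤ r i b) ∧ B.image c = Finset.univ := by
  by_contra! hcon
  obtain ⟨i₀⟩ := ‹Nonempty ι›
  have hsinj : Function.Injective s := fun i j h => by rw [← hc i, h, hc]
  let E : Finset (Finset P × P) := Finset.univ.filter fun p => p.2 ∈ p.1 ∧
    (∀ y, ∃ i, ∀ b ∈ p.1, r i y ≤ r i b) ∧ p.1.card = Fintype.card ι ∧
    (p.1.erase p.2).image c = Finset.univ.erase i₀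
  have heven : Even E.card := by
    rw [Finset.card_eq_sum_card_fiberwise (f := Prod.fst) (t := Finset.univ) (by simp)]
    refine Finset.even_sum _ fun B _ => ?_
    by_cases hB : (∀ y, ∃ i, ∀ b ∈ B, r i y ≤ r i b) ∧ B.card = Fintype.card ι
    · refine (congrArg Even ?_).mpr
        (Finset.even_card_filter_image_erase_eq c i₀ hB.2 (hcon B hB.1))
      refine Finset.card_bij' (fun p _ => p.2) (fun x _ => (B, x)) ?_ ?_ ?_ ?_
      · rintro ⟨B', x⟩ h
        simp only [E, Finset.mem_filter, Finset.mem_univ, true_and] at h ⊢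
        obtain ⟨h, rfl⟩ := h
        exact ⟨h.1, h.2.2.2⟩
      · intro x h
        simp only [E, Finset.mem_filter, Finset.mem_univ, true_and] at h ⊢
        exact ⟨⟨h.1, hB.1, hB.2, h.2⟩, trivial⟩
      · rintro ⟨B', x⟩ h
        simp only [Finset.mem_filter] at h
        rw [h.2]
      · intro x _; rfl
    · rw [Finset.card_eq_zero.2 (Finset.filter_eq_empty_iff.2 ?_)]
      · exact Even.zero
      rintro ⟨B', x⟩ h rfl
      simp only [E, Finset.mem_filter, Finset.mem_univ, true_and] at h
      exact hB ⟨h.2.1, h.2.2.1⟩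
  have hfib : ∀ D : Finset P, D.card + 1 = Fintype.card ι → D.image c = Finset.univ.erase i₀ →
      (E.filter fun p => p.1.erase p.2 = D).card =
        (Finset.univ.filter fun x => x ∉ D ∧ ∀ y, ∃ i, ∀ b ∈ insert x D, r i y ≤ r i b).card := by
    intro D hD hDc
    refine Finset.card_bij' (fun p _ => p.2) (fun x _ => (insert x D, x)) ?_ ?_ ?_ ?_
    · rintro ⟨B, x⟩ h
      simp only [E, Finset.mem_filter, Finset.mem_univ, true_and] at h ⊢
      obtain ⟨h, rfl⟩ := h
      rw [Finset.insert_erase h.1]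
      exact ⟨Finset.notMem_erase _ _, h.2.1⟩
    · intro x h
      simp only [E, Finset.mem_filter, Finset.mem_univ, true_and] at h ⊢
      rw [Finset.erase_insert h.1, Finset.card_insert_of_notMem h.1]
      exact ⟨⟨Finset.mem_insert_self _ _, h.2, hD, hDc⟩, rfl⟩
    · rintro ⟨B, x⟩ h
      simp only [E, Finset.mem_filter, Finset.mem_univ, true_and] at h
      obtain ⟨h, rfl⟩ := h
      rw [Finset.insert_erase h.1]
    · intro x _; rfl
  set D₀ : Finset P := (Finset.univ.erase i₀).image s with hD₀
  have hD₀mem : ∀ i ≠ i₀, s i ∈ D₀ := fun i hi =>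
    Finset.mem_image_of_mem _ (Finset.mem_erase.2 ⟨hi, Finset.mem_univ _⟩)
  have hD₀card : D₀.card + 1 = Fintype.card ι := by
    rw [hD₀, Finset.card_image_of_injective _ hsinj,
      Finset.card_erase_add_one (Finset.mem_univ _), Finset.card_univ]
  have hD₀c : D₀.image c = Finset.univ.erase i₀ := by
    rw [hD₀, Finset.image_image]
    rw [show c ∘ s = id from funext hc, Finset.image_id]
  have hone : (E.filter fun p => p.1.erase p.2 = D₀).card = 1 := by
    rw [hfib D₀ hD₀card hD₀c, Finset.card_eq_one]
    obtain ⟨y, hy⟩ := hs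
    obtain ⟨x, hx, hxmax⟩ := (Finset.univ.filter fun y => y ∉ Set.range s).exists_max_image (r i₀)
      ⟨y, by simpa using hy⟩
    simp only [Finset.mem_filter, Finset.mem_univ, true_and] at hx hxmax
    have hnot : ∀ i y, y ∉ Set.range s → ¬ r i y ≤ r i (s i) := fun i y hy h =>
      hy ⟨i, hr i (le_antisymm (hbot i y) h)⟩
    refine ⟨x, ?_⟩
    ext z
    simp only [Finset.mem_filter, Finset.mem_univ, true_and, Finset.mem_singleton]
    constructor
    · rintro ⟨hz, hdz⟩
      have hzr : z ∉ Set.range s := by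
        rintro ⟨j, rfl⟩
        obtain rfl : j = i₀ := by
          by_contra hj
          exact hz (hD₀mem j hj)
        obtain ⟨i, hi⟩ := hdz y
        refine hnot i y hy (hi _ ?_)
        by_cases hij : i = j
        · rw [hij]; exact Finset.mem_insert_self _ _
        · exact Finset.mem_insert_of_mem (hD₀mem i hij)
      obtain ⟨i, hi⟩ := hdz x
      obtain rfl : i = i₀ := by
        by_contra hij
        exact hnot i x hx (hi _ (Finset.mem_insert_of_mem (hD₀mem i hij)))
      exact hr i (le_antisymm (hxmax z hzr) (hi z (Finset.mem_insert_self _ _)))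
    · rintro rfl
      refine ⟨fun h => ?_, fun y => ?_⟩
      · obtain ⟨i, -, hi⟩ := Finset.mem_image.1 h
        exact hx ⟨i, hi⟩
      · by_cases hy : y ∈ Set.range s
        · obtain ⟨i, rfl⟩ := hy
          exact ⟨i, fun b _ => hbot i b⟩
        · refine ⟨i₀, fun b hb => ?_⟩
          rcases Finset.mem_insert.1 hb with rfl | hb
          · exact hxmax y hy
          · obtain ⟨i, hi, rfl⟩ := Finset.mem_image.1 hb
            exact (htop i₀ i y (Finset.ne_of_mem_erase hi).symm hy).le
  have hothers : ∀ D ≠ D₀, Even (E.filter fun p => p.1.erase p.2 = D).card := by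
    intro D hDne
    by_cases hD : D.card + 1 = Fintype.card ι ∧ D.image c = Finset.univ.erase i₀
    · rw [hfib D hD.1 hD.2]
      obtain ⟨d, hd, hds⟩ : ∃ d ∈ D, d ∉ Set.range s := by
        by_contra! h
        refine hDne (Finset.eq_of_subset_of_card_le (fun d hd => ?_) (by omega))
        obtain ⟨i, rfl⟩ := h d hd
        apply hD₀mem
        have := Finset.mem_image_of_mem c hd
        rw [hD.2, hc] at this
        exact Finset.ne_of_mem_erase this
      by_cases hdom : ∀ y, ∃ i, ∀ b ∈ D, r i y ≤ r i b
      · rw [Finset.card_insert_dominating_eq_two hr hD.1 ⟨d, hd⟩ hdom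
          fun a => ⟨s a, fun j hj => ⟨d, hd, htop j a d hj hds⟩⟩]
        exact even_two
      · rw [Finset.card_eq_zero.2 (Finset.filter_eq_empty_iff.2 ?_)]
        · exact Even.zero
        rintro x - ⟨-, hx⟩
        refine hdom fun y => ?_
        obtain ⟨i, hi⟩ := hx y
        exact ⟨i, fun b hb => hi b (Finset.mem_insert_of_mem hb)⟩
    · rw [Finset.card_eq_zero.2 (Finset.filter_eq_empty_iff.2 ?_)]
      · exact Even.zero
      rintro ⟨B, x⟩ h rfl
      simp only [E, Finset.mem_filter, Finset.mem_univ, true_and] at h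
      refine hD ⟨?_, h.2.2.2⟩
      rw [Finset.card_erase_add_one h.1, h.2.2.1]
  rw [Finset.card_eq_sum_card_fiberwise (f := fun p => p.1.erase p.2) (t := Finset.univ) (by simp),
    ← Finset.add_sum_erase _ _ (Finset.mem_univ D₀), hone] at heven
  have := Finset.even_sum (s := Finset.univ.erase D₀) _ fun D hD =>
    hothers D (Finset.ne_of_mem_erase hD)
  rw [Nat.even_add] at heven
  exact absurd (heven.2 this) Nat.not_even_one

open scoped Classical in
/-- Every colouring of the grid of points of `ι → ℕ` with coordinate sum `N` has a small cell
meeting every colour `i` for which the cell is far from the face where the `i`-th coordinate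
vanishes. -/
theorem exists_grid_cell {ι : Type*} [Fintype ι] [Nonempty ι] (N : ℕ) (c : (ι → ℕ) → ι) :
    ∃ B : Finset (ι → ℕ), B.Nonempty ∧ (∀ k ∈ B, ∑ i, k i = N) ∧
      (∀ k ∈ B, ∀ k' ∈ B, ∀ i, k i ≤ k' i + Fintype.card ι) ∧
      ∀ i, (∃ k ∈ B, c k = i) ∨ ∀ k ∈ B, k i ≤ Fintype.card ι := by
  let G : Finset (ι → ℕ) := Finset.piAntidiag Finset.univ N
  have hG : ∀ k, k ∈ G ↔ ∑ i, k i = N := fun k => by simp [G, Finset.mem_piAntidiag]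
  have hGle : ∀ k : G, ∀ i, k.1 i ≤ N := fun k i => by
    rw [← (hG _).1 k.2]
    exact Finset.single_le_sum (f := k.1) (fun _ _ => Nat.zero_le _) (Finset.mem_univ i)
  let m := Fintype.card G
  let e : G ≃ Fin m := Fintype.equivFin G
  let e' : ι ≃ Fin (Fintype.card ι) := Fintype.equivFin ι
  let r : ι → G ⊕ ι → ℕ := fun i => Sum.elim (fun k => 1 + (k.1 i * m + e k))
    (fun j => if j = i then 0 else 1 + ((N + 1) * m + e' j))
  have hlt : ∀ (i : ι) (k k' : G), k.1 i < k'.1 i → r i (.inl k) < r i (.inl k') := by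
    intro i k k' h
    have h1 := (e k).2
    have h2 : (k.1 i + 1) * m ≤ k'.1 i * m := Nat.mul_le_mul_right _ h
    simp only [r, Sum.elim_inl]
    rw [add_mul] at h2
    omega
  have htop : ∀ (i j : ι) (k : G), i ≠ j → r i (.inl k) < r i (.inr j) := by
    intro i j k h
    have h1 := (e k).2
    have h2 : (k.1 i + 1) * m ≤ (N + 1) * m :=
      Nat.mul_le_mul_right _ (Nat.add_le_add_right (hGle k i) 1)
    simp only [r, Sum.elim_inl, Sum.elim_inr, if_neg h.symm]
    rw [add_mul] at h2
    omega
  have hbot : ∀ i, r i (.inr i) = 0 := fun i => by simp [r]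
  have hpos : ∀ i k, 0 < r i (.inl k) := fun i k => by simp [r]
  have hr : ∀ i, Function.Injective (r i) := by
    rintro i (k | j) (k' | j') h
    · have hk : k.1 i = k'.1 i := by
        rcases lt_trichotomy (k.1 i) (k'.1 i) with h' | h' | h'
        · exact absurd h (hlt i k k' h').ne
        · exact h'
        · exact absurd h (hlt i k' k h').ne'
      simp only [r, Sum.elim_inl, hk] at h
      rw [e.injective (Fin.ext (by omega : (e k : ℕ) = e k'))]
    · by_cases hij : i = j'
      · subst hij
        exact absurd (h.trans (hbot i)) (hpos i k).ne'
      · exact absurd h (htop i j' k hij).ne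
    · by_cases hij : i = j
      · subst hij
        exact absurd (h.symm.trans (hbot i)) (hpos i k').ne'
      · exact absurd h (htop i j k' hij).ne'
    · by_cases hj : j = i <;> by_cases hj' : j' = i
      · rw [hj, hj']
      · simp only [r, Sum.elim_inr, if_pos hj, if_neg hj'] at h
        omega
      · simp only [r, Sum.elim_inr, if_neg hj, if_pos hj'] at h
        omega
      · simp only [r, Sum.elim_inr, if_neg hj, if_neg hj'] at h
        rw [e'.injective (Fin.ext (by omega : (e' j : ℕ) = e' j'))]
  obtain ⟨i₁⟩ := id ‹Nonempty ι›
  have hk₀ : (Pi.single i₁ N : ι → ℕ) ∈ G := by simp [hG]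
  obtain ⟨B, hdom, hcol⟩ := Finset.exists_dominating_image_eq_univ (P := G ⊕ ι) hr (s := Sum.inr)
    (fun i y => by rw [hbot]; exact Nat.zero_le _)
    (by
      rintro i j (k | j') hij hy
      · exact htop i j k hij
      · exact absurd ⟨j', rfl⟩ hy)
    ⟨.inl ⟨_, hk₀⟩, by simp⟩ (c := Sum.elim (fun k => c k.1) id) (fun i => rfl)
  have hdomG : ∀ k : G, ∃ i, .inr i ∉ B ∧ ∀ k' : G, .inl k' ∈ B → k.1 i ≤ k'.1 i := by
    intro k
    obtain ⟨i, hi⟩ := hdom (.inl k)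
    refine ⟨i, fun h => ?_, fun k' hk' => ?_⟩
    · have := hi _ h
      rw [hbot] at this
      exact absurd this (not_le.2 (hpos i k))
    · by_contra! h
      exact absurd (hi _ hk') (not_le.2 (hlt i k' k h))
  have hcolG : ∀ i, .inr i ∉ B → ∃ k : G, .inl k ∈ B ∧ c k.1 = i := by
    intro i hi
    obtain ⟨b, hb, hbi⟩ := Finset.mem_image.1 (hcol.ge (Finset.mem_univ i))
    rcases b with k | j
    · exact ⟨k, hb, hbi⟩
    · exact absurd (by rw [← show j = i from hbi]; exact hb) hi
  let C : Finset ι := Finset.univ.filter fun i => .inr i ∉ B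
  have hC : ∀ i, i ∈ C ↔ .inr i ∉ B := fun i => by simp [C]
  let B' : Finset (ι → ℕ) := G.filter fun k => ∃ h : k ∈ G, .inl ⟨k, h⟩ ∈ B
  have hB' : ∀ k, k ∈ B' ↔ ∃ h : k ∈ G, .inl ⟨k, h⟩ ∈ B := fun k => by
    simp only [B', Finset.mem_filter, and_iff_right_iff_imp]
    exact fun h => h.1
  obtain ⟨i₂, hi₂, -⟩ := hdomG ⟨_, hk₀⟩
  have hne : B'.Nonempty := by
    obtain ⟨k, hk, -⟩ := hcolG i₂ hi₂
    exact ⟨k.1, (hB' _).2 ⟨k.2, hk⟩⟩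
  choose μ hμB hμ using fun i => B'.exists_min_image (fun k => k i) hne
  have hsum : N < ∑ i ∈ C, (μ i i + 1) := by
    by_contra! hle
    let k : ι → ℕ := fun i => (if i ∈ C then μ i i + 1 else 0) +
      (if i = i₂ then N - ∑ i ∈ C, (μ i i + 1) else 0)
    have hk : k ∈ G := by
      rw [hG]
      simp only [k, Finset.sum_add_distrib, Finset.sum_ite_mem, Finset.univ_inter,
        Finset.sum_ite_eq', Finset.mem_univ, if_true]
      simp only [Finset.sum_add_distrib] at hle
      omega
    obtain ⟨i, hi, hki⟩ := hdomG ⟨k, hk⟩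
    obtain ⟨h, hμi⟩ := (hB' _).1 (hμB i)
    have := hki _ hμi
    simp only [k, if_pos ((hC i).2 hi)] at this
    omega
  have hCn : C.card ≤ Fintype.card ι := Finset.card_le_univ C
  rw [Finset.sum_add_distrib, Finset.sum_const, smul_eq_mul, mul_one] at hsum
  have hBsum : ∀ k ∈ B', ∑ i, k i = N := fun k hk => (hG k).1 ((hB' k).1 hk).1
  have hsplit : ∀ k ∈ B', ∑ i ∈ C, k i + ∑ i ∈ Cᶜ, k i = N := fun k hk => by
    rw [Finset.sum_add_sum_compl, hBsum k hk]
  have hCμ : ∀ k ∈ B', ∑ i ∈ C, μ i i ≤ ∑ i ∈ C, k i := fun k hk =>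
    Finset.sum_le_sum fun i _ => hμ i k hk
  have hout : ∀ k ∈ B', ∀ i ∉ C, k i ≤ Fintype.card ι := by
    intro k hk i hi
    have h1 := hsplit k hk
    have h2 := hCμ k hk
    have h3 : k i ≤ ∑ i ∈ Cᶜ, k i :=
      Finset.single_le_sum (fun _ _ => Nat.zero_le _) (Finset.mem_compl.2 hi)
    omega
  refine ⟨B', hne, hBsum, fun k hk k' hk' i => ?_, fun i => ?_⟩
  · by_cases hi : i ∈ C
    · have h1 := hsplit k hk
      have h2 : ∑ j ∈ C.erase i, μ j j ≤ ∑ j ∈ C.erase i, k j :=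
        Finset.sum_le_sum fun j _ => hμ j k hk
      rw [← Finset.add_sum_erase _ _ hi] at h1 hsum
      have h3 := hμ i k' hk'
      omega
    · exact (hout k hk i hi).trans (Nat.le_add_left _ _)
  · by_cases hi : i ∈ C
    · obtain ⟨k, hk, hki⟩ := hcolG i ((hC i).1 hi)
      exact Or.inl ⟨k.1, (hB' _).2 ⟨k.2, hk⟩, hki⟩
    · exact Or.inr fun k hk => hout k hk i hi

theorem stdSimplex.exists_le_add {ι : Type*} [Fintype ι] [Nonempty ι]
    {f : stdSimplex ℝ ι → stdSimplex ℝ ι} (hf : Continuous f) {ε : ℝ} (hε : 0 < ε) :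
    ∃ x, ∀ i, x.1 i ≤ (f x).1 i + ε := by
  classical
  have hcol : ∀ x : stdSimplex ℝ ι, ∃ i, x.1 i ≤ (f x).1 i := by
    intro x
    by_contra! h
    have := Finset.sum_lt_sum_of_nonempty Finset.univ_nonempty fun i _ => h i
    rw [x.2.2, (f x).2.2] at this
    exact lt_irrefl _ this
  choose col hcol using hcol
  obtain ⟨δ, hδ, hfδ⟩ := Metric.uniformContinuous_iff.1
    (CompactSpace.uniformContinuous_of_continuous hf) (ε / 2) (half_pos hε)
  obtain ⟨N, hN⟩ := exists_nat_gt ((Fintype.card ι : ℝ) / min δ (ε / 2))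
  have hmin : 0 < min δ (ε / 2) := lt_min hδ (half_pos hε)
  have hN0 : (0 : ℝ) < N := (by positivity : (0 : ℝ) ≤ _).trans_lt hN
  have hNlt : (Fintype.card ι : ℝ) / N < min δ (ε / 2) := by
    rw [div_lt_iff₀ hmin] at hN
    rw [div_lt_iff₀ hN0, mul_comm]
    exact hN
  have hp : ∀ k : ι → ℕ, ∃ x : stdSimplex ℝ ι, ∑ i, k i = N → ∀ i, x.1 i = k i / N := by
    intro k
    by_cases hk : ∑ i, k i = N
    · refine ⟨⟨fun i => k i / N, fun i => by positivity, ?_⟩, fun _ i => rfl⟩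
      rw [← Finset.sum_div, ← Nat.cast_sum, hk, div_self hN0.ne']
    · exact ⟨⟨_, single_mem_stdSimplex ℝ (Classical.arbitrary ι)⟩, fun h => absurd h hk⟩
  choose p hp using hp
  obtain ⟨B, ⟨k, hk⟩, hsum, hclose, hB⟩ := exists_grid_cell N fun k => col (p k)
  have hdist : ∀ k ∈ B, ∀ k' ∈ B, ∀ i, (p k).1 i ≤ (p k').1 i + Fintype.card ι / N := by
    intro k hk k' hk' i
    rw [hp k (hsum k hk), hp k' (hsum k' hk'), ← add_div]
    gcongr
    exact_mod_cast hclose k hk k' hk' i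
  refine ⟨p k, fun i => ?_⟩
  rcases hB i with ⟨k', hk', hi⟩ | h
  · have h1 : dist (p k') (p k) < δ := by
      refine lt_of_le_of_lt ?_ (hNlt.trans_le (min_le_left _ _))
      rw [Subtype.dist_eq, dist_pi_le_iff (by positivity)]
      intro j
      rw [Real.dist_eq, abs_sub_le_iff]
      constructor
      · linarith [hdist k' hk' k hk j]
      · linarith [hdist k hk k' hk' j]
    have h2 := (dist_le_pi_dist (f (p k')).1 (f (p k)).1 i).trans_lt (hfδ h1)
    rw [Real.dist_eq] at h2
    have h3 := hcol (p k')
    rw [hi] at h3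
    linarith [hdist k hk k' hk' i, (abs_lt.1 h2).2, min_le_right δ (ε / 2)]
  · have h1 : (p k).1 i ≤ Fintype.card ι / N := by
      rw [hp k (hsum k hk)]
      gcongr
      exact_mod_cast h k hk
    linarith [(f (p k)).2.1 i, min_le_right δ (ε / 2)]

/-- **Brouwer's fixed point theorem** for the standard simplex. -/
theorem stdSimplex.exists_isFixedPt {ι : Type*} [Fintype ι] [Nonempty ι]
    {f : stdSimplex ℝ ι → stdSimplex ℝ ι} (hf : Continuous f) : ∃ x, f x = x := by
  classical
  have hcont : Continuous fun x : stdSimplex ℝ ι => ∑ i, max 0 (x.1 i - (f x).1 i) := by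
    refine continuous_finsetSum _ fun i _ => continuous_const.max (.sub ?_ ?_)
    · exact (continuous_apply i).comp continuous_subtype_val
    · exact (continuous_apply i).comp (continuous_subtype_val.comp hf)
  obtain ⟨x, -, hx⟩ := isCompact_univ.exists_isMinOn
    ⟨⟨_, single_mem_stdSimplex ℝ (Classical.arbitrary ι)⟩, Set.mem_univ _⟩ hcont.continuousOn
  have h0 : ∑ i, max 0 (x.1 i - (f x).1 i) ≤ 0 := by
    refine le_of_forall_pos_le_add fun ε hε => ?_
    have hn : (0 : ℝ) < Fintype.card ι := by exact_mod_cast Fintype.card_pos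
    obtain ⟨y, hy⟩ := stdSimplex.exists_le_add hf (div_pos hε hn)
    refine (hx (Set.mem_univ y)).trans ?_
    have : ∑ i, max 0 (y.1 i - (f y).1 i) ≤ ∑ _i : ι, ε / Fintype.card ι :=
      Finset.sum_le_sum fun i _ => max_le (by positivity) (by linarith [hy i])
    rw [Finset.sum_const, Finset.card_univ, nsmul_eq_mul, mul_div_cancel₀ _ hn.ne'] at this
    simpa using this
  have hle : ∀ i ∈ Finset.univ, x.1 i ≤ (f x).1 i := by
    intro i hi
    have h1 := (Finset.single_le_sum (f := fun i => max 0 (x.1 i - (f x).1 i))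
      (fun j _ => le_max_left _ _) hi).trans h0
    linarith [(le_max_right _ _).trans h1]
  have := (Finset.sum_eq_sum_iff_of_le hle).1 (by rw [x.2.2, (f x).2.2])
  exact ⟨x, Subtype.ext (funext fun i => (this i (Finset.mem_univ i)).symm)⟩

/-- Approximate form of **Schauder's fixed point theorem**. -/
theorem Convex.exists_dist_le_of_totallyBounded {E : Type*} [SeminormedAddCommGroup E]
    [NormedSpace ℝ E] {S : Set E} (hS : Convex ℝ S) (hne : S.Nonempty) (htb : TotallyBounded S)
    {T : E → E} (hT : ContinuousOn T S) (hmaps : Set.MapsTo T S S) {ε : ℝ} (hε : 0 < ε) :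
    ∃ x ∈ S, dist (T x) x ≤ ε := by
  obtain ⟨t, htS, htfin, hcov⟩ := Metric.finite_approx_of_totallyBounded htb ε hε
  have : Fintype t := htfin.fintype
  have hnear : ∀ x ∈ S, ∃ p : t, dist (T x) p < ε := by
    intro x hx
    obtain ⟨p, hp, h⟩ := Set.mem_iUnion₂.1 (hcov (hmaps hx))
    exact ⟨⟨p, hp⟩, h⟩
  have : Nonempty t := ⟨(hnear _ hne.some_mem).choose⟩
  let comb : stdSimplex ℝ t → E := fun w => ∑ p : t, w.1 p • (p : E)
  have hcombS : ∀ w, comb w ∈ S := fun w =>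
    hS.sum_mem (fun p _ => w.2.1 p) w.2.2 fun p _ => htS p.2
  have hcomb : Continuous comb := continuous_finsetSum _ fun p _ =>
    ((continuous_apply p).comp continuous_subtype_val).smul continuous_const
  have hTcomb : Continuous fun w => T (comb w) :=
    hT.comp_continuous hcomb hcombS
  let μ : t → stdSimplex ℝ t → ℝ := fun p w => max 0 (ε - dist (T (comb w)) p)
  have hμ : ∀ p, Continuous (μ p) := fun p =>
    continuous_const.max (continuous_const.sub (hTcomb.dist continuous_const))
  have hμ0 : ∀ p w, 0 ≤ μ p w := fun p w => le_max_left _ _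
  have hpos : ∀ w, 0 < ∑ p, μ p w := by
    intro w
    obtain ⟨p, hp⟩ := hnear _ (hcombS w)
    exact Finset.sum_pos' (fun p _ => hμ0 p w)
      ⟨p, Finset.mem_univ p, lt_max_of_lt_right (sub_pos.2 hp)⟩
  let f : stdSimplex ℝ t → stdSimplex ℝ t := fun w =>
    ⟨fun p => μ p w / ∑ q, μ q w, fun p => div_nonneg (hμ0 p w) (hpos w).le, by
      rw [← Finset.sum_div, div_self (hpos w).ne']⟩
  have hf : Continuous f := Continuous.subtype_mk (continuous_pi fun p =>
    (hμ p).div (continuous_finsetSum _ fun q _ => hμ q) fun w => (hpos w).ne') _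
  obtain ⟨w, hw⟩ := stdSimplex.exists_isFixedPt hf
  refine ⟨comb w, hcombS w, ?_⟩
  have hterm : ∀ p : t, w.1 p * dist (T (comb w)) p ≤ w.1 p * ε := by
    intro p
    rcases le_or_gt (dist (T (comb w)) p) ε with h | h
    · exact mul_le_mul_of_nonneg_left h (w.2.1 p)
    · have : w.1 p = 0 := by
        rw [← hw]
        change max 0 (ε - dist (T (comb w)) p) / _ = 0
        rw [max_eq_left (by linarith), zero_div]
      simp [this]
  calc dist (T (comb w)) (comb w) = ‖∑ p : t, w.1 p • (T (comb w) - p)‖ := by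
        rw [dist_eq_norm]
        simp_rw [smul_sub]
        rw [Finset.sum_sub_distrib, ← Finset.sum_smul, w.2.2, one_smul]
    _ ≤ ∑ p : t, w.1 p * dist (T (comb w)) p := by
        refine norm_sum_le_of_le _ fun p _ => ?_
        rw [norm_smul, Real.norm_of_nonneg (w.2.1 p), dist_eq_norm]
    _ ≤ ∑ p : t, w.1 p * ε := Finset.sum_le_sum fun p _ => hterm p
    _ = ε := by rw [← Finset.sum_mul, w.2.2, one_mul]

/-- Uniformly convergent subsequences for the constants `c / (n + 1)` already force the total
masses of the kernel to be bounded. -/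
theorem ProbabilityTheory.Kernel.exists_measureReal_univ_le {X : Type*} [MeasurableSpace X] {c : ℝ}
    (hc : 0 < c) (K : Kernel X X)
    (hcomp : ∀ g : ℕ → X → ℝ, (∀ n, Measurable (g n)) → (∀ n x, |g n x| ≤ c) →
      ∃ σ : ℕ → ℕ, StrictMono σ ∧ ∃ F : X → ℝ,
        TendstoUniformly (fun k x => ∫ y, g (σ k) y ∂(K x)) F atTop) :
    ∃ M, ∀ x, (K x).real Set.univ ≤ M := by
  obtain ⟨σ, hσ, F, hF⟩ := hcomp (fun n _ => c / (n + 1)) (fun n => measurable_const) fun n x => by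
    rw [abs_of_nonneg (by positivity)]
    exact div_le_self hc.le (by linarith [(Nat.cast_nonneg n : (0 : ℝ) ≤ n)])
  simp only [MeasureTheory.integral_const, smul_eq_mul] at hF
  have hF0 : ∀ x, F x = 0 := by
    intro x
    refine tendsto_nhds_unique (hF.tendsto_at x) ?_
    have h1 : Tendsto (fun n : ℕ => (1 : ℝ) / (n + 1)) atTop (nhds 0) :=
      tendsto_one_div_add_atTop_nhds_zero_nat
    have h2 := ((h1.comp hσ.tendsto_atTop).const_mul ((K x).real Set.univ * c))
    rw [mul_zero] at h2
    refine h2.congr fun n => ?_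
    simp only [Function.comp_apply]
    ring
  obtain ⟨k, hk⟩ := (Metric.tendstoUniformly_iff.1 hF 1 one_pos).exists
  refine ⟨(σ k + 1) / c, fun x => ?_⟩
  have h := hk x
  have hp : (0 : ℝ) < σ k + 1 := by positivity
  rw [hF0, Real.dist_eq, zero_sub, abs_neg] at h
  have h' := (le_abs_self _).trans h.le
  rw [mul_div_assoc', div_le_one hp] at h'
  rwa [le_div_iff₀ hc]

/-- Solvability of the equation `u + Kφ(·, u) = v` for a kernel with the compactness property. -/
theorem ProbabilityTheory.Kernel.exists_add_integral_comp_eq {X : Type*} [MeasurableSpace X] {c : ℝ}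
    (hc : 0 < c) (K : Kernel X X) (hKfin : ∀ x, K x Set.univ < ⊤)
    (hcomp : ∀ g : ℕ → X → ℝ, (∀ n, Measurable (g n)) → (∀ n x, |g n x| ≤ c) →
      ∃ σ : ℕ → ℕ, StrictMono σ ∧ ∃ F : X → ℝ,
        TendstoUniformly (fun k x => ∫ y, g (σ k) y ∂(K x)) F atTop)
    {φ : X → ℝ → ℝ} (hφm : Measurable (Function.uncurry φ))
    (hφb : ∀ x t, |φ x t| ≤ c) (hφc : ∀ x, Continuous (φ x)) {v : X → ℝ} (hv : Measurable v) :
    ∃ u : X → ℝ, Measurable u ∧ ∀ x, u x + ∫ y, φ y (u y) ∂(K x) = v x := by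
  have hfin : ∀ x, IsFiniteMeasure (K x) := fun x => ⟨hKfin x⟩
  obtain ⟨M, hM⟩ := K.exists_measureReal_univ_le hc hcomp
  have : IsFiniteKernel K := ⟨ENNReal.ofReal M, ENNReal.ofReal_lt_top, fun x => by
    rw [← ENNReal.ofReal_toReal (hKfin x).ne]
    exact ENNReal.ofReal_le_ofReal (hM x)⟩
  let _ : TopologicalSpace X := ⊥
  have : DiscreteTopology X := ⟨rfl⟩
  have hbound : ∀ g : X → ℝ, (∀ x, |g x| ≤ c) → ∀ x, ‖∫ y, g y ∂(K x)‖ ≤ c * M := fun g hg x =>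
    (norm_integral_le_of_norm_le_const (Eventually.of_forall hg)).trans
      (mul_le_mul_of_nonneg_left (hM x) hc.le)
  let A : Set (X → ℝ) := {g | Measurable g ∧ ∀ x, |g x| ≤ c}
  let I : A → BoundedContinuousFunction X ℝ := fun g =>
    BoundedContinuousFunction.ofNormedAddCommGroupDiscrete (fun x => ∫ y, g.1 y ∂(K x)) (c * M)
      (hbound g.1 g.2.2)
  let T : BoundedContinuousFunction X ℝ → BoundedContinuousFunction X ℝ := fun f =>
    BoundedContinuousFunction.ofNormedAddCommGroupDiscrete
      (fun x => ∫ y, φ y (v y - f y) ∂(K x)) (c * M) (hbound _ fun x => hφb _ _)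
  have hI : ∀ g x, I g x = ∫ y, g.1 y ∂(K x) := fun g x => rfl
  have hT : ∀ f x, T f x = ∫ y, φ y (v y - f y) ∂(K x) := fun f x => rfl
  have hImeas : ∀ g, Measurable (I g) := fun g =>
    (StronglyMeasurable.integral_kernel g.2.1.stronglyMeasurable).measurable
  have hφv : ∀ f : X → ℝ, Measurable f → (fun y => φ y (v y - f y)) ∈ A := fun f hf =>
    ⟨hφm.comp (measurable_id.prodMk (hv.sub hf)), fun x => hφb _ _⟩
  have hTmem : ∀ f : BoundedContinuousFunction X ℝ, Measurable f → T f ∈ Set.range I :=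
    fun f hf => ⟨⟨_, hφv f hf⟩, rfl⟩
  have hsub : ∀ f : ℕ → BoundedContinuousFunction X ℝ, (∀ n, f n ∈ Set.range I) →
      ∃ σ : ℕ → ℕ, StrictMono σ ∧ ∃ F : BoundedContinuousFunction X ℝ, Measurable F ∧
        Tendsto (fun n => f (σ n)) atTop (nhds F) := by
    intro f hf
    choose g hg using hf
    obtain ⟨σ, hσ, F, hF⟩ := hcomp (fun n => (g n).1) (fun n => (g n).2.1) fun n => (g n).2.2
    have hFb : ∀ x, ‖F x‖ ≤ c * M := fun x =>
      le_of_tendsto (hF.tendsto_at x).norm (Eventually.of_forall fun n => hbound _ (g (σ n)).2.2 x)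
    refine ⟨σ, hσ, BoundedContinuousFunction.ofNormedAddCommGroupDiscrete F (c * M) hFb, ?_, ?_⟩
    · exact measurable_of_tendsto_metrizable (fun n => hImeas (g (σ n)))
        (tendsto_pi_nhds.2 hF.tendsto_at)
    · rw [BoundedContinuousFunction.tendsto_iff_tendstoUniformly]
      simp_rw [← hg]
      exact hF
  have hTlim : ∀ (f : ℕ → BoundedContinuousFunction X ℝ) (F : BoundedContinuousFunction X ℝ),
      (∀ n, Measurable (f n)) → Tendsto f atTop (nhds F) →
      ∀ x, Tendsto (fun n => T (f n) x) atTop (nhds (T F x)) := by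
    intro f F hf hlim x
    simp_rw [hT]
    refine tendsto_integral_of_dominated_convergence (fun _ => c)
      (fun n => (hφv _ (hf n)).1.aestronglyMeasurable) (integrable_const c)
      (fun n => Eventually.of_forall fun y => hφb _ _) (Eventually.of_forall fun y => ?_)
    refine ((hφc y).tendsto _).comp (tendsto_const_nhds.sub ?_)
    exact (BoundedContinuousFunction.tendsto_iff_tendstoUniformly.1 hlim).tendsto_at y
  have hmeas : ∀ f ∈ Set.range I, Measurable f := by
    rintro _ ⟨g, rfl⟩
    exact hImeas g
  have hint : ∀ (g : A) x, Integrable g.1 (K x) := fun g x =>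
    Integrable.of_bound g.2.1.aestronglyMeasurable c (Eventually.of_forall g.2.2)
  have hconv : Convex ℝ (Set.range I) := by
    rintro _ ⟨g, rfl⟩ _ ⟨g', rfl⟩ a b ha hb hab
    refine ⟨⟨fun x => a * g.1 x + b * g'.1 x,
      (g.2.1.const_mul a).add (g'.2.1.const_mul b), fun x => ?_⟩, ?_⟩
    · calc |a * g.1 x + b * g'.1 x| ≤ |a * g.1 x| + |b * g'.1 x| := abs_add_le _ _
        _ = a * |g.1 x| + b * |g'.1 x| := by
          rw [abs_mul, abs_mul, abs_of_nonneg ha, abs_of_nonneg hb]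
        _ ≤ a * c + b * c := by gcongr; exacts [g.2.2 x, g'.2.2 x]
        _ = c := by rw [← add_mul, hab, one_mul]
    · ext x
      simp only [BoundedContinuousFunction.add_apply, BoundedContinuousFunction.smul_apply,
        hI, smul_eq_mul]
      rw [integral_add ((hint g x).const_mul a) ((hint g' x).const_mul b),
        integral_const_mul, integral_const_mul]
  have htb : TotallyBounded (Set.range I) := by
    rw [Metric.totallyBounded_iff]
    by_contra! h
    obtain ⟨ε, hε, h⟩ := h
    obtain ⟨f, hf, hsep⟩ := exists_seq_of_forall_finset_exists (· ∈ Set.range I)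
      (fun x y => ε ≤ dist y x) fun s _ => by
        obtain ⟨y, hy, hys⟩ := Set.not_subset.1 (h s s.finite_toSet)
        refine ⟨y, hy, fun x hx => ?_⟩
        by_contra! hlt
        exact hys (Set.mem_iUnion₂.2 ⟨x, hx, hlt⟩)
    obtain ⟨σ, hσ, F, -, hF⟩ := hsub f hf
    obtain ⟨N, hN⟩ := Metric.cauchySeq_iff.1 hF.cauchySeq ε hε
    exact absurd (hN (N + 1) (Nat.le_succ N) N le_rfl)
      (not_lt.2 (hsep _ _ (hσ (Nat.lt_succ_self N))))
  have hcont : ContinuousOn T (Set.range I) := by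
    rw [continuousOn_iff_continuous_domRestrict, continuous_iff_seqContinuous]
    intro f p hfp
    refine tendsto_of_subseq_tendsto fun ns hns => ?_
    have hlim : Tendsto (fun n => (f (ns n)).1) atTop (nhds p.1) :=
      (continuous_subtype_val.tendsto p).comp (hfp.comp hns)
    obtain ⟨σ, hσ, F, -, hF⟩ := hsub (fun n => T (f (ns n)).1)
      fun n => hTmem _ (hmeas _ (f (ns n)).2)
    have hFT : F = T p.1 := by
      ext x
      exact tendsto_nhds_unique
        ((BoundedContinuousFunction.tendsto_iff_tendstoUniformly.1 hF).tendsto_at x)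
        ((hTlim _ _ (fun n => hmeas _ (f (ns n)).2) hlim x).comp hσ.tendsto_atTop)
    rw [hFT] at hF
    exact ⟨σ, hF⟩
  have happrox : ∀ n : ℕ, ∃ f ∈ Set.range I, dist (T f) f ≤ 1 / (n + 1) := fun n =>
    hconv.exists_dist_le_of_totallyBounded
      ⟨_, hTmem 0 measurable_const⟩ htb hcont
      (fun f hf => hTmem f (hmeas f hf)) Nat.one_div_pos_of_nat
  choose f hf hfT using happrox
  obtain ⟨σ, hσ, F, hFm, hF⟩ := hsub f hf
  have hTf : Tendsto (fun n => T (f (σ n))) atTop (nhds F) := by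
    refine (tendsto_iff_of_dist (squeeze_zero (fun _ => dist_nonneg) (fun n => hfT (σ n)) ?_)).2 hF
    exact tendsto_one_div_add_atTop_nhds_zero_nat.comp hσ.tendsto_atTop
  refine ⟨fun x => v x - F x, hv.sub hFm, fun x => ?_⟩
  have : T F x = F x := tendsto_nhds_unique (hTlim _ F (fun n => hmeas _ (hf (σ n))) hF x)
    ((BoundedContinuousFunction.tendsto_iff_tendstoUniformly.1 hTf).tendsto_at x)
  rw [← hT, this, sub_add_cancel]

theorem stmt_8 {X : Type*} [mX : MeasurableSpace X] (c : ℝ) (hc : 0 < c) (K : Kernel X X)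
    (hKfin : ∀ x, K x Set.univ < ⊤)
    (hcomp : ∀ g : ℕ → X → ℝ, (∀ n, Measurable (g n)) → (∀ n x, |g n x| ≤ c) →
      ∃ σ : ℕ → ℕ, StrictMono σ ∧ ∃ F : X → ℝ,
        TendstoUniformly (fun k x => ∫ y, g (σ k) y ∂(K x)) F atTop)
    (φ : X → ℝ → ℝ) (hφm : Measurable (Function.uncurry φ))
    (hφb : ∀ x t, |φ x t| ≤ c) (hφc : ∀ x, Continuous (φ x))
    (v : X → ℝ) (hv : Measurable v) :
    (∃ u : X → ℝ, Measurable u ∧ (∀ x, u x + ∫ y, φ y (u y) ∂(K x) = v x) ∧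
        ∀ x, |u x - v x| ≤ c * (K x Set.univ).toReal) ∧
    (∀ τ : TopologicalSpace X, @BorelSpace X τ mX →
      (∀ g : X → ℝ, Measurable g → (∀ x, |g x| ≤ c) →
        @Continuous X ℝ τ inferInstance (fun x => ∫ y, g y ∂(K x))) →
      @Continuous X ℝ τ inferInstance v →
      ∃ u : X → ℝ, @Continuous X ℝ τ inferInstance u ∧
        (∀ x, u x + ∫ y, φ y (u y) ∂(K x) = v x) ∧
        ∀ x, |u x - v x| ≤ c * (K x Set.univ).toReal) := by
  obtain ⟨u, hu, hsol⟩ := K.exists_add_integral_comp_eq hc hKfin hcomp hφm hφb hφc hv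
  have hdiff : ∀ x, |u x - v x| ≤ c * (K x Set.univ).toReal := by
    intro x
    have : IsFiniteMeasure (K x) := ⟨hKfin x⟩
    rw [abs_sub_comm, ← hsol x, add_sub_cancel_left]
    exact norm_integral_le_of_norm_le_const (f := fun y => φ y (u y))
      (Eventually.of_forall fun y => hφb _ _)
  refine ⟨⟨u, hu, hsol, hdiff⟩, fun τ _ hKc hvc => ⟨u, ?_, hsol, hdiff⟩⟩
  have hKu := hKc (fun y => φ y (u y)) (hφm.comp (measurable_id.prodMk hu)) fun y => hφb _ _
  exact (hvc.sub hKu).congr fun x => by rw [Pi.sub_apply, ← hsol x, add_sub_cancel_right]
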